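/- arXiv:1902.00202 — 3 statements merged into one kernel-verified Lean document; each statement's English description precedes it below -/
import Mathlib

section
/- Let n be a positive integer, P and Q n×n real symmetric positive semidefinite matrices, A and C arbitrary n×n real matrices, B ∈ ℝⁿ, and λ > 0. Then the matrix P' = Cᵀ Q C + Aᵀ P A − (1/(λ + Bᵀ P B)) · Aᵀ P (B Bᵀ) P A is symmetric and positive semidefinite. -/
open Matrix

namespace Matrix

variable {n : Type*} [Fintype n]

theorem dotProduct_transpose_mul_mul_mulVec (M N S : Matrix n n ℝ) (x y : n → ℝ) :
    x ⬝ᵥ (Mᵀ * S * N) *ᵥ y = (M *ᵥ x) ⬝ᵥ S *ᵥ (N *ᵥ y) := by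
  rw [← mulVec_mulVec, ← mulVec_mulVec, dotProduct_mulVec, vecMul_transpose]

theorem dotProduct_vecMulVec_self_mulVec (b x : n → ℝ) :
    x ⬝ᵥ vecMulVec b b *ᵥ x = (x ⬝ᵥ b) ^ 2 := by
  rw [dotProduct_mulVec, vecMul_vecMulVec, smul_dotProduct, smul_eq_mul, dotProduct_comm b x, sq]

theorem IsSymm.transpose_mul_mul_same {S : Matrix n n ℝ} (hS : S.IsSymm) (M : Matrix n n ℝ) :
    (Mᵀ * S * M).IsSymm := by
  simp only [IsSymm, transpose_mul, transpose_transpose, hS.eq, Matrix.mul_assoc]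

theorem IsSymm.dotProduct_mulVec_comm {S : Matrix n n ℝ} (hS : S.IsSymm) (x y : n → ℝ) :
    x ⬝ᵥ S *ᵥ y = y ⬝ᵥ S *ᵥ x := by
  rw [dotProduct_mulVec, ← mulVec_transpose, hS.eq, dotProduct_comm]

/-- A regularized Cauchy–Schwarz inequality for a positive semidefinite form. -/
theorem one_div_add_mul_sq_dotProduct_mulVec_le {P : Matrix n n ℝ} (hP : P.IsSymm)
    (hpsd : ∀ x : n → ℝ, 0 ≤ x ⬝ᵥ P *ᵥ x) {r : ℝ} (hr : 0 < r) (b y : n → ℝ) :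
    1 / (r + b ⬝ᵥ P *ᵥ b) * (y ⬝ᵥ P *ᵥ b) ^ 2 ≤ y ⬝ᵥ P *ᵥ y := by
  have hb := hpsd b
  have hs : 0 < r + b ⬝ᵥ P *ᵥ b := by linarith
  have h := hpsd ((r + b ⬝ᵥ P *ᵥ b) • y - (y ⬝ᵥ P *ᵥ b) • b)
  simp only [mulVec_sub, mulVec_smul, sub_dotProduct, dotProduct_sub, smul_dotProduct,
    dotProduct_smul, smul_eq_mul, hP.dotProduct_mulVec_comm b y] at h
  generalize b ⬝ᵥ P *ᵥ b = β at *
  generalize y ⬝ᵥ P *ᵥ b = c at *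
  generalize y ⬝ᵥ P *ᵥ y = a at *
  rw [one_div_mul_eq_div, div_le_iff₀ hs]
  refine le_of_mul_le_mul_left ?_ hs
  nlinarith [mul_nonneg hr.le (sq_nonneg c)]

end Matrix

/-- The Riccati update
`P' = Cᵀ Q C + Aᵀ P A − (1/(λ + Bᵀ P B)) Aᵀ P (B Bᵀ) P A`
preserves symmetry and positive semidefiniteness. -/
theorem stmt2 {n : ℕ} (hn : 0 < n) (P Q : Matrix (Fin n) (Fin n) ℝ)
    (hPsymm : P.IsSymm) (hPpsd : ∀ x : Fin n → ℝ, 0 ≤ x ⬝ᵥ P.mulVec x)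
    (hQsymm : Q.IsSymm) (hQpsd : ∀ x : Fin n → ℝ, 0 ≤ x ⬝ᵥ Q.mulVec x)
    (A C : Matrix (Fin n) (Fin n) ℝ) (B : Fin n → ℝ) (lam : ℝ) (hlam : 0 < lam)
    (P' : Matrix (Fin n) (Fin n) ℝ)
    (hP' : P' = Cᵀ * Q * C + Aᵀ * P * A
        - (1 / (lam + B ⬝ᵥ P.mulVec B)) • (Aᵀ * P * vecMulVec B B * P * A)) :
    P'.IsSymm ∧ ∀ x : Fin n → ℝ, 0 ≤ x ⬝ᵥ P'.mulVec x := by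
  subst hP'
  have hK : Aᵀ * P * vecMulVec B B * P * A = (P * A)ᵀ * vecMulVec B B * (P * A) := by
    simp only [transpose_mul, hPsymm.eq, Matrix.mul_assoc]
  rw [hK]
  refine ⟨((hQsymm.transpose_mul_mul_same C).add (hPsymm.transpose_mul_mul_same A)).sub
    ((IsSymm.transpose_mul_mul_same (transpose_vecMulVec B B) (P * A)).smul _), fun x => ?_⟩
  have hPA : ((P * A) *ᵥ x) ⬝ᵥ B = (A *ᵥ x) ⬝ᵥ P *ᵥ B := by
    rw [← mulVec_mulVec, dotProduct_comm, hPsymm.dotProduct_mulVec_comm]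
  simp only [sub_mulVec, add_mulVec, smul_mulVec, dotProduct_sub, dotProduct_add, dotProduct_smul,
    smul_eq_mul, dotProduct_transpose_mul_mul_mulVec, dotProduct_vecMulVec_self_mulVec, hPA]
  linarith [hQpsd (C *ᵥ x),
    one_div_add_mul_sq_dotProduct_mulVec_le hPsymm hPpsd hlam B (A *ᵥ x)]
end

section
/- (ILQR Bellman step, core of the paper's Theorem 2.) Let n be a positive integer, P an n×n real symmetric positive semidefinite matrix, Q an n×n real symmetric positive semidefinite matrix, C and D_x n×n real matrices, D_u, q, y, x̃ ∈ ℝⁿ, ũ, r ∈ ℝ, and λ > 0. For z ∈ ℝⁿ define h_z : ℝ → ℝ by h_z(v) = λ (v + ũ)² + (D_x z + v·D_u)ᵀ P (D_x z + v·D_u) + (D_x z + v·D_u)ᵀ q + r. Then: (i) h_z attains its minimum over ℝ at the unique point v*(z) = −(2·D_uᵀ P D_x z + D_uᵀ q + 2 λ ũ)/(2·(λ + D_uᵀ P D_u)); and (ii) for every z, (C(z + x̃) − y)ᵀ Q (C(z + x̃) − y) + h_z(v*(z)) = zᵀ P' z + zᵀ q' + r', where P' = Cᵀ Q C + D_xᵀ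 P D_x − (1/(λ + D_uᵀ P D_u))·D_xᵀ P (D_u D_uᵀ) P D_x, q' = 2·Cᵀ Q (C x̃ − y) + D_xᵀ q − ((D_uᵀ q + 2 λ ũ)/(λ + D_uᵀ P D_u))·D_xᵀ P D_u, and r' = (C x̃ − y)ᵀ Q (C x̃ − y) + λ ũ² + r − (D_uᵀ q + 2 λ ũ)²/(4·(λ + D_uᵀ P D_u)). -/
open Matrix

theorem Matrix.IsSymm.dotProduct_mulVec_comm_s8 {n : ℕ} {A : Matrix (Fin n) (Fin n) ℝ}
    (hA : A.IsSymm) (u v : Fin n → ℝ) : u ⬝ᵥ A *ᵥ v = v ⬝ᵥ A *ᵥ u := by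
  rw [dotProduct_mulVec, ← mulVec_transpose, hA.eq, dotProduct_comm]

theorem Matrix.dotProduct_transpose_mulVec_eq {n : ℕ} (A : Matrix (Fin n) (Fin n) ℝ)
    (u v : Fin n → ℝ) : u ⬝ᵥ Aᵀ *ᵥ v = (A *ᵥ u) ⬝ᵥ v := by
  rw [dotProduct_mulVec, vecMul_transpose]

theorem Matrix.IsSymm.dotProduct_mulVec_add_self {n : ℕ} {A : Matrix (Fin n) (Fin n) ℝ}
    (hA : A.IsSymm) (u v : Fin n → ℝ) :
    (u + v) ⬝ᵥ A *ᵥ (u + v) = u ⬝ᵥ A *ᵥ u + 2 * (u ⬝ᵥ A *ᵥ v) + v ⬝ᵥ A *ᵥ v := by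
  simp only [mulVec_add, add_dotProduct, dotProduct_add]
  rw [hA.dotProduct_mulVec_comm_s8 v u]
  ring

/-- ILQR Bellman step, core of the paper's Theorem 2:
`h_z(v) = λ(v + ũ)² + (D_x z + v D_u)ᵀ P (D_x z + v D_u) + (D_x z + v D_u)ᵀ q + r`
attains its minimum at the unique point
`v*(z) = −(2 D_uᵀ P D_x z + D_uᵀ q + 2 λ ũ)/(2(λ + D_uᵀ P D_u))`, and adding the
stage cost `(C(z + x̃) − y)ᵀ Q (C(z + x̃) − y)` yields `zᵀ P' z + zᵀ q' + r'`. -/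
theorem stmt8 {n : ℕ} (hn : 0 < n) (P Q : Matrix (Fin n) (Fin n) ℝ)
    (hPsymm : P.IsSymm) (hPpsd : ∀ x : Fin n → ℝ, 0 ≤ x ⬝ᵥ P.mulVec x)
    (hQsymm : Q.IsSymm) (hQpsd : ∀ x : Fin n → ℝ, 0 ≤ x ⬝ᵥ Q.mulVec x)
    (C Dx : Matrix (Fin n) (Fin n) ℝ) (Du q y xt : Fin n → ℝ) (ut r : ℝ)
    (lam : ℝ) (hlam : 0 < lam)
    (h : (Fin n → ℝ) → ℝ → ℝ)
    (hdef : ∀ z v, h z v =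
      lam * (v + ut) ^ 2
        + (Dx.mulVec z + v • Du) ⬝ᵥ P.mulVec (Dx.mulVec z + v • Du)
        + (Dx.mulVec z + v • Du) ⬝ᵥ q + r)
    (vstar : (Fin n → ℝ) → ℝ)
    (hvstar : ∀ z, vstar z =
      -(2 * (Du ⬝ᵥ P.mulVec (Dx.mulVec z)) + Du ⬝ᵥ q + 2 * lam * ut)
        / (2 * (lam + Du ⬝ᵥ P.mulVec Du)))
    (P' : Matrix (Fin n) (Fin n) ℝ) (q' : Fin n → ℝ) (r' : ℝ)
    (hP' : P' = Cᵀ * Q * C + Dxᵀ * P * Dx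
        - (1 / (lam + Du ⬝ᵥ P.mulVec Du)) • (Dxᵀ * P * vecMulVec Du Du * P * Dx))
    (hq' : q' = (2 : ℝ) • (Cᵀ * Q).mulVec (C.mulVec xt - y) + Dxᵀ.mulVec q
        - ((Du ⬝ᵥ q + 2 * lam * ut) / (lam + Du ⬝ᵥ P.mulVec Du)) •
            (Dxᵀ * P).mulVec Du)
    (hr' : r' = (C.mulVec xt - y) ⬝ᵥ Q.mulVec (C.mulVec xt - y) + lam * ut ^ 2 + r
        - (Du ⬝ᵥ q + 2 * lam * ut) ^ 2 / (4 * (lam + Du ⬝ᵥ P.mulVec Du))) :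
    (∀ z, (∀ v : ℝ, h z (vstar z) ≤ h z v) ∧
      (∀ v : ℝ, (∀ v' : ℝ, h z v ≤ h z v') → v = vstar z)) ∧
    (∀ z, (C.mulVec (z + xt) - y) ⬝ᵥ Q.mulVec (C.mulVec (z + xt) - y) + h z (vstar z)
        = z ⬝ᵥ P'.mulVec z + z ⬝ᵥ q' + r') := by
  have hS : 0 < lam + Du ⬝ᵥ P *ᵥ Du := add_pos_of_pos_of_nonneg hlam (hPpsd Du)
  have hexpand : ∀ z v, h z v = lam * (v + ut) ^ 2 +
      ((Dx *ᵥ z) ⬝ᵥ P *ᵥ (Dx *ᵥ z) + 2 * (v * (Du ⬝ᵥ P *ᵥ (Dx *ᵥ z)))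
        + v ^ 2 * (Du ⬝ᵥ P *ᵥ Du)) + ((Dx *ᵥ z) ⬝ᵥ q + v * (Du ⬝ᵥ q)) + r := by
    intro z v
    rw [hdef, hPsymm.dotProduct_mulVec_add_self, hPsymm.dotProduct_mulVec_comm_s8 (Dx *ᵥ z) (v • Du)]
    simp only [mulVec_smul, smul_dotProduct, dotProduct_smul, add_dotProduct, smul_eq_mul]
    ring
  have hsquare : ∀ z v, h z v = h z (vstar z)
      + (lam + Du ⬝ᵥ P *ᵥ Du) * (v - vstar z) ^ 2 := by
    intro z v
    have hstat : 2 * (lam + Du ⬝ᵥ P *ᵥ Du) * vstar z =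
        -(2 * (Du ⬝ᵥ P *ᵥ (Dx *ᵥ z)) + Du ⬝ᵥ q + 2 * lam * ut) := by
      rw [hvstar]
      field_simp
    rw [hexpand z v, hexpand z (vstar z)]
    linear_combination (v - vstar z) * hstat
  refine ⟨fun z => ⟨fun v => ?_, fun v hv => ?_⟩, fun z => ?_⟩
  · rw [hsquare z v]
    exact le_add_of_nonneg_right (by positivity)
  · have hle := hv (vstar z)
    rw [hsquare z v] at hle
    have hzero : (lam + Du ⬝ᵥ P *ᵥ Du) * (v - vstar z) ^ 2 = 0 :=
      le_antisymm (by linarith) (by positivity)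
    simpa [hS.ne', sub_eq_zero] using hzero
  · have hstage : (C *ᵥ (z + xt) - y) ⬝ᵥ Q *ᵥ (C *ᵥ (z + xt) - y) =
        (C *ᵥ z) ⬝ᵥ Q *ᵥ (C *ᵥ z) + 2 * ((C *ᵥ z) ⬝ᵥ Q *ᵥ (C *ᵥ xt - y))
          + (C *ᵥ xt - y) ⬝ᵥ Q *ᵥ (C *ᵥ xt - y) := by
      rw [mulVec_add, add_sub_assoc, hQsymm.dotProduct_mulVec_add_self]
    have hquad : z ⬝ᵥ P' *ᵥ z = (C *ᵥ z) ⬝ᵥ Q *ᵥ (C *ᵥ z)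
        + (Dx *ᵥ z) ⬝ᵥ P *ᵥ (Dx *ᵥ z)
        - 1 / (lam + Du ⬝ᵥ P *ᵥ Du) * (Du ⬝ᵥ P *ᵥ (Dx *ᵥ z)) ^ 2 := by
      rw [hP']
      simp only [sub_mulVec, add_mulVec, smul_mulVec, ← mulVec_mulVec, dotProduct_sub,
        dotProduct_add, dotProduct_smul, dotProduct_transpose_mulVec_eq, vecMulVec_mulVec,
        op_smul_eq_smul, mulVec_smul, smul_eq_mul]
      rw [hPsymm.dotProduct_mulVec_comm_s8 (Dx *ᵥ z) Du]
      ring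
    have hlin : z ⬝ᵥ q' = 2 * ((C *ᵥ z) ⬝ᵥ Q *ᵥ (C *ᵥ xt - y)) + (Dx *ᵥ z) ⬝ᵥ q
        - (Du ⬝ᵥ q + 2 * lam * ut) / (lam + Du ⬝ᵥ P *ᵥ Du)
          * (Du ⬝ᵥ P *ᵥ (Dx *ᵥ z)) := by
      rw [hq', hPsymm.dotProduct_mulVec_comm_s8 Du (Dx *ᵥ z)]
      simp only [← mulVec_mulVec, dotProduct_sub, dotProduct_add, dotProduct_smul,
        dotProduct_transpose_mulVec_eq, smul_eq_mul]
    rw [hstage, hquad, hlin, hr', hexpand, hvstar]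
    field_simp
    ring
end

section
/- Let (Ω, μ) be a probability space and w : Ω → ℝ a random variable with w and w² integrable, ∫ w dμ = 0 and ∫ w² dμ = σ². Let n and m be positive integers, a, B ∈ ℝⁿ, C an n×n real matrix, and for k = 1, …, m let Q_k be an n×n real matrix and y_k ∈ ℝⁿ. Then ∫ Σ_{k=1}^{m} (C^k (a + w(ω)·B) − y_k)ᵀ Q_k (C^k (a + w(ω)·B) − y_k) dμ(ω) = Σ_{k=1}^{m} (C^k a − y_k)ᵀ Q_k (C^k a − y_k) + σ² · Σ_{k=1}^{m} (C^k B)ᵀ Q_k (C^k B), where C^k denotes the k-th matrix power of C. -/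
open Matrix MeasureTheory

/-- A quadratic form along the line `t ↦ u + t • v` is a quadratic polynomial in `t`. -/
theorem dotProduct_mulVec_add_smul {ι R : Type*} [Fintype ι] [CommRing R]
    (M : Matrix ι ι R) (u v : ι → R) (t : R) :
    (u + t • v) ⬝ᵥ M.mulVec (u + t • v)
      = u ⬝ᵥ M.mulVec u + (u ⬝ᵥ M.mulVec v + v ⬝ᵥ M.mulVec u) * t
        + (v ⬝ᵥ M.mulVec v) * t ^ 2 := by
  simp only [mulVec_add, mulVec_smul, dotProduct_add, add_dotProduct, smul_dotProduct,
    dotProduct_smul, smul_eq_mul]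
  ring

/-- The expectation of a quadratic polynomial in a centered random variable. -/
theorem integral_quadratic_of_integral_eq_zero {Ω : Type*} [MeasurableSpace Ω]
    {μ : Measure Ω} [IsProbabilityMeasure μ] {w : Ω → ℝ} (hw1 : Integrable w μ)
    (hw2 : Integrable (fun ω => w ω ^ 2) μ) (hmean : ∫ ω, w ω ∂μ = 0) (p q r : ℝ) :
    ∫ ω, (p + q * w ω + r * w ω ^ 2) ∂μ = p + r * ∫ ω, w ω ^ 2 ∂μ := by
  have hlin : Integrable (fun ω => p + q * w ω) μ :=
    (integrable_const p).add (hw1.const_mul q)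
  rw [integral_add hlin (hw2.const_mul r),
    integral_add (integrable_const p) (hw1.const_mul q), integral_const_mul,
    integral_const_mul, hmean]
  simp

/-- the attacker's expected instantaneous cost under mean-zero noise
`w` of variance `σ²` decomposes into the nominal (noiseless) cost plus a
noise-variance term:
`E[ Σ_k (C^k(a + wB) − y_k)ᵀ Q_k (C^k(a + wB) − y_k) ]
  = Σ_k (C^k a − y_k)ᵀ Q_k (C^k a − y_k) + σ² Σ_k (C^k B)ᵀ Q_k (C^k B)`. -/
theorem stmt13 {Ω : Type*} [MeasurableSpace Ω] (μ : Measure Ω) [IsProbabilityMeasure μ]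
    (w : Ω → ℝ) (hw1 : Integrable w μ) (hw2 : Integrable (fun ω => (w ω) ^ 2) μ)
    (hmean : ∫ ω, w ω ∂μ = 0) (σ : ℝ) (hvar : ∫ ω, (w ω) ^ 2 ∂μ = σ ^ 2)
    {n m : ℕ} (hn : 0 < n) (hm : 0 < m)
    (a B : Fin n → ℝ) (C : Matrix (Fin n) (Fin n) ℝ)
    (Q : ℕ → Matrix (Fin n) (Fin n) ℝ) (y : ℕ → Fin n → ℝ) :
    ∫ ω, (∑ k ∈ Finset.Icc 1 m,
        ((C ^ k).mulVec (a + w ω • B) - y k) ⬝ᵥ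
          (Q k).mulVec ((C ^ k).mulVec (a + w ω • B) - y k)) ∂μ
      = (∑ k ∈ Finset.Icc 1 m,
          ((C ^ k).mulVec a - y k) ⬝ᵥ (Q k).mulVec ((C ^ k).mulVec a - y k))
        + σ ^ 2 * ∑ k ∈ Finset.Icc 1 m,
            ((C ^ k).mulVec B) ⬝ᵥ (Q k).mulVec ((C ^ k).mulVec B) := by
  have expand (k : ℕ) (t : ℝ) :
      (C ^ k).mulVec (a + t • B) - y k
        = ((C ^ k).mulVec a - y k) + t • (C ^ k).mulVec B := by
    rw [mulVec_add, mulVec_smul]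
    abel
  simp only [expand, dotProduct_mulVec_add_smul, Finset.sum_add_distrib, ← Finset.sum_mul]
  rw [integral_quadratic_of_integral_eq_zero hw1 hw2 hmean, hvar, mul_comm (σ ^ 2)]
end
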